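/- Let b ∈ (0,1) and c, τ > 0, and suppose the characteristic function χ₁ has no negative real zero. Then there is no function w : ℝ → ℝ that is a nondecreasing, twice continuously differentiable, bounded solution of w''(t) − c·w'(t) + (Bw)(t)·(1 − (1−b)·(SBw)(t)) = 0 with w(−∞) = 0, w(+∞) = 1, and w(t) < 1 for all t ∈ ℝ. -/

import Mathlib

open Filter

/-- Characteristic function χ₁(z) = z² − c·z − e^{−z·c·τ}/(1 − b·e^{−z·c·τ}). -/
noncomputable def chi1 (b c τ z : ℝ) : ℝ :=
  z ^ 2 - c * z - Real.exp (-(z * c * τ)) / (1 - b * Real.exp (-(z * c * τ)))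

/-- `(Bw)(t) = Σ_{j≥0} b^j w(t − j·c·τ)`. -/
noncomputable def Bop (b c τ : ℝ) (w : ℝ → ℝ) (t : ℝ) : ℝ :=
  ∑' j : ℕ, b ^ j * w (t - (j : ℝ) * c * τ)

/-- `(SBw)(t) = Σ_{j≥0} b^j w(t − (j+1)·c·τ)`. -/
noncomputable def SBop (b c τ : ℝ) (w : ℝ → ℝ) (t : ℝ) : ℝ :=
  ∑' j : ℕ, b ^ j * w (t - ((j : ℝ) + 1) * c * τ)

/-- A function with nonpositive derivative on `[T, ∞)` is antitone there. -/
lemma antitoneOn_Ici_of_hasDerivAt {f f' : ℝ → ℝ} {T : ℝ} (hf : ∀ t, HasDerivAt f (f' t) t)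
    (h : ∀ t, T ≤ t → f' t ≤ 0) : AntitoneOn f (Set.Ici T) := by
  refine antitoneOn_of_deriv_nonpos (convex_Ici T) (fun t _ => (hf t).continuousAt.continuousWithinAt)
    (fun t _ => (hf t).differentiableAt.differentiableWithinAt) fun t ht => ?_
  rw [interior_Ici] at ht
  rw [(hf t).deriv]
  exact h t (le_of_lt ht)

/-- If `v' + l v ≤ 0` on `[T, ∞)`, then `v` decays there at least like `e^{-l t}`. -/
lemma exp_mul_le_of_deriv_add_mul_nonpos {v v₁ : ℝ → ℝ} {l T : ℝ}
    (hv : ∀ t, HasDerivAt v (v₁ t) t) (h : ∀ t, T ≤ t → v₁ t + l * v t ≤ 0) {s t : ℝ}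
    (hs : T ≤ s) (hst : s ≤ t) : Real.exp (l * (t - s)) * v t ≤ v s := by
  have hd : ∀ x, HasDerivAt (fun x => Real.exp (l * (x - s)) * v x)
      (Real.exp (l * (x - s)) * (v₁ x + l * v x)) x := fun x => by
    have h1 : HasDerivAt (fun x => l * (x - s)) (l * 1) x :=
      ((hasDerivAt_id x).sub_const s).const_mul l
    exact (h1.exp.mul (hv x)).congr_deriv (by ring)
  have := antitoneOn_Ici_of_hasDerivAt hd
    (fun x hx => mul_nonpos_of_nonneg_of_nonpos (Real.exp_pos _).le (h x hx)) hs
    (hs.trans hst : T ≤ t) hst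
  simpa using this

/-- A function that is bounded above and satisfies `u' ≥ k u` with `k > 0` is nonpositive. -/
lemma nonpos_of_mul_le_deriv_of_bounded {u u' : ℝ → ℝ} {k T M : ℝ} (hk : 0 < k)
    (hu : ∀ t, HasDerivAt u (u' t) t) (hge : ∀ t, T ≤ t → k * u t ≤ u' t)
    (hM : ∀ t, T ≤ t → u t ≤ M) {t : ℝ} (ht : T ≤ t) : u t ≤ 0 := by
  by_contra! hpos
  have hgrow : ∀ x, t ≤ x → u t * (1 + k * (x - t)) ≤ M := fun x hx => by
    have h1 := exp_mul_le_of_deriv_add_mul_nonpos (v := fun y => -u y) (v₁ := fun y => -u' y)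
      (l := -k) (T := T) (fun y => (hu y).neg) (fun y hy => by have := hge y hy; linarith) ht hx
    have h2 : u t * Real.exp (k * (x - t)) ≤ u x := by
      have h3 : Real.exp (k * (x - t)) * Real.exp (-k * (x - t)) = 1 := by
        rw [← Real.exp_add]; simp
      have h4 := mul_le_mul_of_nonneg_left h1 (Real.exp_pos (k * (x - t))).le
      have h5 : Real.exp (k * (x - t)) * (Real.exp (-k * (x - t)) * -u x) = -u x := by
        rw [← mul_assoc, h3, one_mul]
      linarith
    have h6 := Real.add_one_le_exp (k * (x - t))
    have h7 := hM x (ht.trans hx)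
    nlinarith
  have hM0 : 0 < M := hpos.trans_le (hM t ht)
  have h := hgrow (t + M / (k * u t)) (by have : 0 < M / (k * u t) := by positivity
                                          linarith)
  have : u t * (1 + k * (t + M / (k * u t) - t)) = u t + M := by field_simp; ring
  linarith

/-- If `v'' - c v' ≥ K v` for a bounded nonnegative nonincreasing `v`, then `v' + m v ≤ 0` for
every `m ≥ 0` with `m² + c m ≤ K`. -/
lemma deriv_add_mul_nonpos {v v₁ v₂ : ℝ → ℝ} {c K m M T : ℝ} (hc : 0 < c) (hm : 0 ≤ m)
    (hv : ∀ t, HasDerivAt v (v₁ t) t) (hv₁ : ∀ t, HasDerivAt v₁ (v₂ t) t)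
    (hv0 : ∀ t, 0 ≤ v t) (hvM : ∀ t, v t ≤ M) (hdec : ∀ t, v₁ t ≤ 0)
    (hK : m ^ 2 + c * m ≤ K) (h : ∀ t, T ≤ t → K * v t ≤ v₂ t - c * v₁ t) {t : ℝ}
    (ht : T ≤ t) : v₁ t + m * v t ≤ 0 := by
  refine nonpos_of_mul_le_deriv_of_bounded (u := fun x => v₁ x + m * v x)
    (u' := fun x => v₂ x + m * v₁ x) (k := c + m) (M := m * M) (T := T) (by linarith)
    (fun x => (hv₁ x).add ((hv x).const_mul m)) (fun x hx => ?_) (fun x _ => ?_) ht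
  · have := h x hx
    have := mul_le_mul_of_nonneg_right hK (hv0 x)
    linarith
  · have := mul_le_mul_of_nonneg_left (hvM x) hm
    linarith [hdec x]

/-- If `v'' - c v' ≥ C e^{-l t}` for a nonincreasing `v` tending to zero, then `v` is bounded
below by a multiple of `e^{-l t}`. -/
lemma exists_mul_exp_neg_le {v v₁ v₂ : ℝ → ℝ} {c C l T : ℝ} (hc : 0 < c) (hC : 0 < C)
    (hl : 0 < l) (hv : ∀ t, HasDerivAt v (v₁ t) t) (hv₁ : ∀ t, HasDerivAt v₁ (v₂ t) t)
    (hdec : ∀ t, v₁ t ≤ 0) (hlim : Tendsto v atTop (nhds 0))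
    (h : ∀ t, T ≤ t → C * Real.exp (-l * t) ≤ v₂ t - c * v₁ t) :
    ∃ δ > 0, ∀ t, T ≤ t → δ * Real.exp (-l * t) ≤ v t := by
  have hexp : ∀ x, HasDerivAt (fun x => Real.exp (-l * x)) (-l * Real.exp (-l * x)) x := fun x => by
    have h1 : HasDerivAt (fun x => -l * x) (-l * 1) x := (hasDerivAt_id x).const_mul (-l)
    exact h1.exp.congr_deriv (by ring)
  set δ := C / (l + c) with hδ
  have hδ0 : 0 < δ := by positivity
  have hδC : δ * (l + c) = C := by rw [hδ]; field_simp
  have hu : ∀ t, T ≤ t → v₁ t + δ * Real.exp (-l * t) ≤ 0 := fun t ht => by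
    refine nonpos_of_mul_le_deriv_of_bounded (u := fun x => v₁ x + δ * Real.exp (-l * x))
      (u' := fun x => v₂ x + δ * (-l * Real.exp (-l * x))) (k := c) (T := T)
      (M := δ * Real.exp (-l * T)) hc
      (fun x => (hv₁ x).add ((hexp x).const_mul δ)) (fun x hx => ?_) (fun x hx => ?_) ht
    · have := h x hx
      rw [← hδC] at this
      linarith
    · have : Real.exp (-l * x) ≤ Real.exp (-l * T) := Real.exp_le_exp.2 (by nlinarith)
      have := mul_le_mul_of_nonneg_left this hδ0.le
      linarith [hdec x]
  refine ⟨δ / l, by positivity, fun t ht => ?_⟩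
  have hanti : AntitoneOn (fun x => v x - δ / l * Real.exp (-l * x)) (Set.Ici T) :=
    antitoneOn_Ici_of_hasDerivAt (fun x => (hv x).sub ((hexp x).const_mul (δ / l)))
      fun x hx => by
        have := hu x hx
        have e : δ / l * (-l * Real.exp (-l * x)) = -(δ * Real.exp (-l * x)) := by field_simp
        rw [e]; linarith
  have hlim' : Tendsto (fun x => v x - δ / l * Real.exp (-l * x)) atTop (nhds 0) := by
    have h1 : Tendsto (fun x : ℝ => Real.exp (-l * x)) atTop (nhds 0) :=
      Real.tendsto_exp_atBot.comp ((tendsto_const_mul_atBot_of_neg (by linarith)).2 tendsto_id)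
    simpa using hlim.sub (h1.const_mul (δ / l))
  have := le_of_tendsto hlim' ((eventually_ge_atTop t).mono fun x hx =>
    hanti ht (ht.trans hx : T ≤ x) hx)
  linarith

/-- Without negative zeros, `χ₁` is negative at every `-σ ≤ 0` to the right of its pole. -/
lemma chi1_neg_of_no_negative_zero {b c τ σ : ℝ} (hb : b ∈ Set.Ioo (0 : ℝ) 1)
    (hc : 0 < c) (hτ : 0 < τ) (hno : ¬ ∃ z < (0 : ℝ), chi1 b c τ z = 0) (hσ : 0 ≤ σ)
    (hpole : b * Real.exp (σ * (c * τ)) < 1) : chi1 b c τ (-σ) < 0 := by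
  by_contra! hge
  have h0 : chi1 b c τ 0 < 0 := by
    have : 0 < 1 / (1 - b) := one_div_pos.2 (by linarith [hb.2])
    simp only [chi1]
    simpa using this
  have hcont : ContinuousOn (chi1 b c τ) (Set.Icc (-σ) 0) := by
    unfold chi1
    refine ContinuousOn.sub (by fun_prop) (ContinuousOn.div (by fun_prop) (by fun_prop) ?_)
    intro z hz
    have h1 : Real.exp (-(z * c * τ)) ≤ Real.exp (σ * (c * τ)) := by
      apply Real.exp_le_exp.2
      have := mul_nonneg (by linarith [hz.1] : 0 ≤ z + σ) (mul_pos hc hτ).le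
      linarith
    have := mul_le_mul_of_nonneg_left h1 hb.1.le
    linarith
  obtain ⟨z, hz, hz0⟩ := intermediate_value_Icc' (by linarith) hcont ⟨h0.le, hge⟩
  refine hno ⟨z, lt_of_le_of_ne hz.2 ?_, hz0⟩
  rintro rfl
  exact h0.ne hz0

/-- Some finite truncation of the linearized delay term dominates `σ² + c σ` at every `σ ≥ 0`,
provided `χ₁` has no negative zero. -/
lemma exists_lt_sum_of_no_negative_zero {b c τ σ : ℝ} (hb : b ∈ Set.Ioo (0 : ℝ) 1)
    (hc : 0 < c) (hτ : 0 < τ) (hno : ¬ ∃ z < (0 : ℝ), chi1 b c τ z = 0) (hσ : 0 ≤ σ) :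
    ∃ N : ℕ, σ ^ 2 + c * σ <
      ∑ j ∈ Finset.range N, b ^ j * Real.exp (σ * (((j : ℝ) + 1) * c * τ)) := by
  set q := b * Real.exp (σ * (c * τ)) with hq
  have hq0 : 0 < q := mul_pos hb.1 (Real.exp_pos _)
  have hterm : ∀ j : ℕ, b ^ j * Real.exp (σ * (((j : ℝ) + 1) * c * τ))
      = Real.exp (σ * (c * τ)) * q ^ j := fun j => by
    rw [hq, mul_pow, ← Real.exp_nat_mul, mul_left_comm (Real.exp _), ← Real.exp_add]
    ring_nf
  simp only [hterm, ← Finset.mul_sum]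
  rcases lt_or_ge q 1 with h1 | h1
  · have hchi := chi1_neg_of_no_negative_zero hb hc hτ hno hσ h1
    have hlim : Tendsto (fun N : ℕ => Real.exp (σ * (c * τ)) * ∑ j ∈ Finset.range N, q ^ j) atTop
        (nhds (Real.exp (σ * (c * τ)) * (1 - q)⁻¹)) :=
      ((hasSum_geometric_of_lt_one hq0.le h1).tendsto_sum_nat).const_mul _
    refine (hlim.eventually_const_lt ?_).exists
    have e : -(-σ * c * τ) = σ * (c * τ) := by ring
    simp only [chi1, e, ← hq] at hchi
    rw [← div_eq_mul_inv]
    linarith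
  · obtain ⟨N, hN⟩ := exists_nat_gt (σ ^ 2 + c * σ)
    refine ⟨N, hN.trans_le ?_⟩
    have hsum : (N : ℝ) ≤ ∑ j ∈ Finset.range N, q ^ j := by
      simpa using Finset.card_nsmul_le_sum (Finset.range N) (fun j => q ^ j) 1
        fun j _ => one_le_pow₀ h1
    have hexp : 1 ≤ Real.exp (σ * (c * τ)) := Real.one_le_exp (by positivity)
    nlinarith [Nat.cast_nonneg (α := ℝ) N]

/-- A geometrically weighted series of translates of a bounded function converges. -/
lemma summable_pow_mul_of_abs_le {b C : ℝ} (hb : b ∈ Set.Ioo (0 : ℝ) 1) {f : ℕ → ℝ}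
    (hf : ∀ j, |f j| ≤ C) : Summable fun j : ℕ => b ^ j * f j := by
  refine Summable.of_norm_bounded
    ((summable_geometric_of_lt_one hb.1.le hb.2).mul_right C) fun j => ?_
  rw [norm_mul, norm_pow, Real.norm_of_nonneg hb.1.le]
  exact mul_le_mul_of_nonneg_left (hf j) (pow_nonneg hb.1.le j)

/-- `(1 - b) Bw` tends to the limit of `w` at `+∞`. -/
lemma tendsto_one_sub_mul_Bop {b c τ C L : ℝ} (hb : b ∈ Set.Ioo (0 : ℝ) 1) {w : ℝ → ℝ}
    (hw : ∀ t, |w t| ≤ C) (hlim : Tendsto w atTop (nhds L)) :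
    Tendsto (fun t => (1 - b) * Bop b c τ w t) atTop (nhds L) := by
  have h : Tendsto (fun t => Bop b c τ w t) atTop (nhds (∑' j : ℕ, b ^ j * L)) := by
    refine tendsto_tsum_of_dominated_convergence (bound := fun j : ℕ => b ^ j * C)
      ((summable_geometric_of_lt_one hb.1.le hb.2).mul_right C) (fun j => ?_)
      (Eventually.of_forall fun t j => ?_)
    · exact (hlim.comp (tendsto_atTop_add_const_right atTop (-((j : ℝ) * c * τ))
        tendsto_id)).const_mul (b ^ j)
    · rw [norm_mul, norm_pow, Real.norm_of_nonneg hb.1.le]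
      exact mul_le_mul_of_nonneg_left (hw _) (pow_nonneg hb.1.le j)
  have hb1 : 1 - b ≠ 0 := by linarith [hb.2]
  have e : (1 - b) * ∑' j : ℕ, b ^ j * L = L := by
    rw [tsum_mul_right, tsum_geometric_of_lt_one hb.1.le hb.2, mul_inv_cancel_left₀ hb1]
  simpa only [e] using h.const_mul (1 - b)

/-- `1 - (1 - b) SBw = (1 - b) SB(1 - w)`. -/
lemma one_sub_mul_SBop {b c τ C : ℝ} (hb : b ∈ Set.Ioo (0 : ℝ) 1) {w : ℝ → ℝ}
    (hw : ∀ t, |w t| ≤ C) (t : ℝ) :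
    1 - (1 - b) * SBop b c τ w t = (1 - b) * SBop b c τ (fun s => 1 - w s) t := by
  have hb1 : 1 - b ≠ 0 := by linarith [hb.2]
  simp only [SBop, mul_sub, mul_one]
  rw [(summable_geometric_of_lt_one hb.1.le hb.2).tsum_sub
    (summable_pow_mul_of_abs_le hb fun j => hw _), tsum_geometric_of_lt_one hb.1.le hb.2,
    mul_sub, mul_inv_cancel₀ hb1]

/-- For a positive nonincreasing `v`, the delay term `SBv` decays no faster than `b^{t/(cτ)}`. -/
lemma mul_exp_le_SBop {b c τ C : ℝ} (hb : b ∈ Set.Ioo (0 : ℝ) 1) (hc : 0 < c) (hτ : 0 < τ)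
    {v : ℝ → ℝ} (hv0 : ∀ t, 0 < v t) (hanti : Antitone v) (hv : ∀ t, |v t| ≤ C) {t : ℝ}
    (ht : 0 ≤ t) : v 0 * Real.exp (-(-Real.log b / (c * τ)) * t) ≤ SBop b c τ v t := by
  have hh : 0 < c * τ := mul_pos hc hτ
  set j := ⌊t / (c * τ)⌋₊
  have hj1 : (j : ℝ) ≤ t / (c * τ) := Nat.floor_le (by positivity)
  have hj2 : t < ((j : ℝ) + 1) * (c * τ) := (div_lt_iff₀ hh).1 (Nat.lt_floor_add_one _)
  have hsum : b ^ j * v (t - ((j : ℝ) + 1) * c * τ) ≤ SBop b c τ v t :=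
    (summable_pow_mul_of_abs_le hb fun i => hv (t - ((i : ℝ) + 1) * c * τ)).le_tsum j
      fun i _ => mul_nonneg (pow_nonneg hb.1.le i) (hv0 _).le
  have hpow : Real.exp (-(-Real.log b / (c * τ)) * t) ≤ b ^ j := by
    rw [← Real.exp_log hb.1, ← Real.exp_nat_mul, Real.exp_log hb.1]
    apply Real.exp_le_exp.2
    have := mul_le_mul_of_nonpos_right hj1 (Real.log_neg hb.1 hb.2).le
    calc _ = t / (c * τ) * Real.log b := by ring
      _ ≤ _ := this
  refine le_trans ?_ hsum
  rw [mul_comm]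
  exact mul_le_mul hpow (hanti (by linarith)) (hv0 0).le (pow_nonneg hb.1.le j)

/-- If `v' + l v ≤ 0` eventually, then eventually `SBv` dominates every finite truncation of the
delay term of the linearization at rate `l`, times `v`. -/
lemma eventually_sum_mul_le_SBop {b c τ C l : ℝ} (hb : b ∈ Set.Ioo (0 : ℝ) 1) (hc : 0 < c)
    (hτ : 0 < τ) {v v₁ : ℝ → ℝ} (hv : ∀ t, HasDerivAt v (v₁ t) t) (hv0 : ∀ t, 0 < v t)
    (hvC : ∀ t, |v t| ≤ C) (hl : ∀ᶠ t in atTop, v₁ t + l * v t ≤ 0) (N : ℕ) :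
    ∀ᶠ t in atTop, (∑ j ∈ Finset.range N, b ^ j * Real.exp (l * (((j : ℝ) + 1) * c * τ))) * v t
      ≤ SBop b c τ v t := by
  obtain ⟨T, hT⟩ := eventually_atTop.1 hl
  filter_upwards [eventually_ge_atTop (T + N * c * τ)] with t ht
  have hsum : ∑ j ∈ Finset.range N, b ^ j * v (t - ((j : ℝ) + 1) * c * τ) ≤ SBop b c τ v t :=
    (summable_pow_mul_of_abs_le hb fun _ => hvC _).sum_le_tsum (Finset.range N)
      fun i _ => mul_nonneg (pow_nonneg hb.1.le i) (hv0 _).le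
  refine le_trans ?_ hsum
  rw [Finset.sum_mul]
  refine Finset.sum_le_sum fun j hj => ?_
  have hjN : (j : ℝ) + 1 ≤ N := by exact_mod_cast Finset.mem_range.1 hj
  have hh := mul_le_mul_of_nonneg_right hjN (mul_pos hc hτ).le
  have hpos : 0 ≤ ((j : ℝ) + 1) * c * τ := by positivity
  have h := exp_mul_le_of_deriv_add_mul_nonpos hv hT
    (s := t - ((j : ℝ) + 1) * c * τ) (t := t) (by linarith) (by linarith)
  rw [sub_sub_cancel] at h
  rw [mul_assoc]
  exact mul_le_mul_of_nonneg_left h (pow_nonneg hb.1.le j)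

/-- If `χ₁` has no negative zero, then `v'' - c v' = a(t) SBv` with `a(+∞) = 1` has no bounded
positive nonincreasing solution tending to zero. -/
lemma no_positive_decaying_solution {b c τ C : ℝ} (hb : b ∈ Set.Ioo (0 : ℝ) 1) (hc : 0 < c)
    (hτ : 0 < τ) (hno : ¬ ∃ z < (0 : ℝ), chi1 b c τ z = 0) {a v v₁ v₂ : ℝ → ℝ}
    (ha : Tendsto a atTop (nhds 1)) (hv : ∀ t, HasDerivAt v (v₁ t) t)
    (hv₁ : ∀ t, HasDerivAt v₁ (v₂ t) t) (hv0 : ∀ t, 0 < v t) (hanti : Antitone v)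
    (hvC : ∀ t, |v t| ≤ C) (hlim : Tendsto v atTop (nhds 0))
    (hode : ∀ t, v₂ t - c * v₁ t = a t * SBop b c τ v t) : False := by
  have hdec : ∀ t, v₁ t ≤ 0 := fun t => (hv t).deriv ▸ hanti.deriv_nonpos
  set l₀ := -Real.log b / (c * τ) with hl₀
  have hl₀pos : 0 < l₀ := div_pos (neg_pos.2 (Real.log_neg hb.1 hb.2)) (mul_pos hc hτ)
  obtain ⟨T, hT⟩ := eventually_atTop.1
    ((ha.eventually_const_lt (by norm_num : (1 / 2 : ℝ) < 1)).and (eventually_ge_atTop 0))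
  obtain ⟨δ, hδ, hlow⟩ := exists_mul_exp_neg_le (C := v 0 / 2) (l := l₀) (T := T) hc
    (half_pos (hv0 0)) hl₀pos hv hv₁ hdec hlim fun t ht => by
      have h1 := mul_exp_le_SBop hb hc hτ hv0 hanti hvC (hT t ht).2
      have h2 : 0 < v 0 * Real.exp (-l₀ * t) := mul_pos (hv0 0) (Real.exp_pos _)
      rw [hode]
      nlinarith [(hT t ht).1]
  set Λ : Set ℝ := {l | 0 ≤ l ∧ ∀ᶠ t in atTop, v₁ t + l * v t ≤ 0}
  have hΛ0 : (0 : ℝ) ∈ Λ := ⟨le_rfl, Eventually.of_forall fun t => by simpa using hdec t⟩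
  have hΛbdd : BddAbove Λ := by
    refine ⟨l₀, fun l hl => ?_⟩
    by_contra! hlt
    obtain ⟨T', hT'⟩ := eventually_atTop.1 (hl.2.and (eventually_ge_atTop T))
    have hup : ∀ t, T' ≤ t → δ * Real.exp (-(l * T')) * Real.exp ((l - l₀) * t) ≤ v T' :=
      fun t ht => by
        have h1 := exp_mul_le_of_deriv_add_mul_nonpos hv (fun s hs => (hT' s hs).1) le_rfl ht
        have h2 := mul_le_mul_of_nonneg_left (hlow t (hT' t ht).2)
          (Real.exp_pos (l * (t - T'))).le
        refine le_trans (le_of_eq ?_) (h2.trans h1)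
        rw [mul_assoc, ← Real.exp_add, mul_left_comm, ← Real.exp_add]
        ring_nf
    have htend : Tendsto (fun t => δ * Real.exp (-(l * T')) * Real.exp ((l - l₀) * t))
        atTop atTop :=
      (Real.tendsto_exp_atTop.comp (tendsto_id.const_mul_atTop (sub_pos.2 hlt))).const_mul_atTop
        (mul_pos hδ (Real.exp_pos _))
    obtain ⟨t, ht1, ht2⟩ :=
      ((htend.eventually_gt_atTop (v T')).and (eventually_ge_atTop T')).exists
    exact absurd (hup t ht2) (not_le.2 ht1)
  set σ := sSup Λ
  obtain ⟨N, hN⟩ := exists_lt_sum_of_no_negative_zero hb hc hτ hno (le_csSup hΛbdd hΛ0 : 0 ≤ σ)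
  obtain ⟨m, hmσ, hm⟩ : ∃ m, σ < m ∧ m ^ 2 + c * m <
      ∑ j ∈ Finset.range N, b ^ j * Real.exp (σ * (((j : ℝ) + 1) * c * τ)) := by
    have hcont : ContinuousAt (fun m : ℝ => m ^ 2 + c * m) σ := by fun_prop
    have h1 := (hcont.eventually_lt_const hN).filter_mono (nhdsWithin_le_nhds (s := Set.Ioi σ))
    obtain ⟨m, h2, h3⟩ := (h1.and self_mem_nhdsWithin).exists
    exact ⟨m, h3, h2⟩
  obtain ⟨l, hl, hlm⟩ : ∃ l ∈ Λ, m ^ 2 + c * m <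
      ∑ j ∈ Finset.range N, b ^ j * Real.exp (l * (((j : ℝ) + 1) * c * τ)) := by
    have hcont : ContinuousAt (fun l : ℝ =>
        ∑ j ∈ Finset.range N, b ^ j * Real.exp (l * (((j : ℝ) + 1) * c * τ))) σ := by fun_prop
    obtain ⟨ε, hε, hball⟩ := Metric.eventually_nhds_iff.1 (hcont.eventually_const_lt hm)
    obtain ⟨l, hl, hlσ⟩ := exists_lt_of_lt_csSup ⟨0, hΛ0⟩ (sub_lt_self σ hε)
    refine ⟨l, hl, hball ?_⟩
    have := le_csSup hΛbdd hl
    rw [Real.dist_eq, abs_lt]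
    constructor <;> linarith
  set G := ∑ j ∈ Finset.range N, b ^ j * Real.exp (l * (((j : ℝ) + 1) * c * τ))
  have hm0 : 0 ≤ m := (le_csSup hΛbdd hΛ0).trans hmσ.le
  have haG : Tendsto (fun t => a t * G) atTop (nhds G) := by simpa using ha.mul_const G
  obtain ⟨T', hT'⟩ := eventually_atTop.1 ((haG.eventually_const_lt hlm).and
    ((eventually_sum_mul_le_SBop hb hc hτ hv hv0 hvC hl.2 N).and (eventually_ge_atTop T)))
  refine absurd (le_csSup hΛbdd ⟨hm0, eventually_atTop.2 ⟨T', fun t ht => ?_⟩⟩) (not_le.2 hmσ)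
  refine deriv_add_mul_nonpos (T := T') hc hm0 hv hv₁ (fun s => (hv0 s).le)
    (fun s => (le_abs_self _).trans (hvC s)) hdec le_rfl (fun s hs => ?_) ht
  obtain ⟨h1, h2, h3⟩ := hT' s hs
  have ha0 : 0 ≤ a s := by linarith [(hT s h3).1]
  rw [hode]
  calc (m ^ 2 + c * m) * v s ≤ a s * G * v s := mul_le_mul_of_nonneg_right h1.le (hv0 s).le
    _ = a s * (G * v s) := mul_assoc _ _ _
    _ ≤ _ := mul_le_mul_of_nonneg_left h2 ha0

/-- If `χ₁` has no negative real zero, then there is no nondecreasing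
bounded `C²` solution `w` of `w'' − cw' + (Bw)(1 − (1−b)(SBw)) = 0` with `w(−∞)=0`,
`w(+∞)=1` and `w(t) < 1` for all `t`. -/
theorem no_front_without_negative_zero (b c τ : ℝ) (hb : b ∈ Set.Ioo (0 : ℝ) 1)
    (hc : 0 < c) (hτ : 0 < τ)
    (hno : ¬ ∃ z < (0 : ℝ), chi1 b c τ z = 0) :
    ¬ ∃ w : ℝ → ℝ, Monotone w ∧ ContDiff ℝ 2 w ∧ (∃ C : ℝ, ∀ t, |w t| ≤ C) ∧
      (∀ t : ℝ, deriv (deriv w) t - c * deriv w t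
        + Bop b c τ w t * (1 - (1 - b) * SBop b c τ w t) = 0) ∧
      Tendsto w atBot (nhds 0) ∧ Tendsto w atTop (nhds 1) ∧ (∀ t : ℝ, w t < 1) := by
  rintro ⟨w, hmono, hC2, ⟨C, hC⟩, hode, -, htop, hlt⟩
  have hd : ∀ t, HasDerivAt w (deriv w t) t := fun t =>
    (hC2.differentiable (by norm_num) t).hasDerivAt
  have hd₁ : ∀ t, HasDerivAt (deriv w) (deriv (deriv w) t) t := fun t =>
    (((contDiff_succ_iff_deriv (n := 1)).1 hC2).2.2.differentiable (by norm_num) t).hasDerivAt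
  refine no_positive_decaying_solution (C := 1 + C) hb hc hτ hno (v := fun t => 1 - w t)
    (tendsto_one_sub_mul_Bop (c := c) (τ := τ) hb hC htop)
    (fun t => (hd t).const_sub 1) (fun t => (hd₁ t).neg) (fun t => sub_pos.2 (hlt t))
    (fun s t hst => sub_le_sub_left (hmono hst) 1) (fun t => ?_)
    (by simpa using htop.const_sub 1) (fun t => ?_)
  · exact (abs_sub 1 (w t)).trans (by simpa using hC t)
  · have h := hode t
    rw [one_sub_mul_SBop hb hC] at h
    linarith
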